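/- For every integer n ≥ 2, the infimum over nonzero smooth compactly supported functions φ on (0,∞) of the quotient (∫_0^∞ φ'(s)² (1+s²)^{1/2} s^n ds) / (∫_0^∞ φ(s)² (1+s²)^{1/2} s^{n-2} ds) equals (n-1)²/4. -/

import Mathlib

open MeasureTheory Real Set

lemma aux_w_contDiff : ContDiff ℝ (⊤ : ℕ∞) (fun s : ℝ => (1 + s^2) ^ ((1:ℝ)/2)) := by
  apply ContDiff.rpow_const_of_ne
  · fun_prop
  · intro x; positivity

lemma aux_w_deriv (s : ℝ) : HasDerivAt (fun s : ℝ => (1 + s^2) ^ ((1:ℝ)/2))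
    (s * (1 + s^2) ^ ((1:ℝ)/2 - 1)) s := by
  have h1 : HasDerivAt (fun s : ℝ => 1 + s^2) (2 * s) s := by
    simpa using (hasDerivAt_pow 2 s).const_add 1
  have h2 := h1.rpow_const (p := (1:ℝ)/2) (Or.inl (by positivity))
  convert h2 using 1
  ring

lemma aux_den_pos (m : ℕ) (φ : ℝ → ℝ) (h1 : ContDiff ℝ (⊤ : ℕ∞) φ) (h2 : HasCompactSupport φ)
    (h3 : tsupport φ ⊆ Ioi 0) (h4 : φ ≠ 0) :
    0 < ∫ s in Ioi (0:ℝ), (φ s)^2 * (1 + s^2) ^ ((1:ℝ)/2) * s^m := by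
  have hz : ∀ x, x ∉ Ioi (0:ℝ) → φ x = 0 := fun x hx =>
    image_eq_zero_of_notMem_tsupport (fun h => hx (h3 h))
  rw [setIntegral_eq_integral_of_forall_compl_eq_zero (fun x hx => by simp [hz x hx])]
  obtain ⟨x, hx⟩ := Function.ne_iff.1 h4
  have hx0 : 0 < x := by
    by_contra h
    exact hx (hz x h)
  apply Continuous.integral_pos_of_hasCompactSupport_nonneg_nonzero (x := x)
  · exact ((h1.continuous.pow 2).mul aux_w_contDiff.continuous).mul (continuous_pow m)
  · apply HasCompactSupport.mul_right
    apply HasCompactSupport.mul_right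
    exact h2.comp_left (g := fun y : ℝ => y^2) (by simp)
  · intro y
    by_cases hy : y ∈ Ioi (0:ℝ)
    · have : 0 < y := hy
      simp only [Pi.zero_apply]
      positivity
    · simp [hz y hy]
  · have : φ x ≠ 0 := hx
    positivity

lemma aux_lower (m : ℕ) (φ : ℝ → ℝ) (h1 : ContDiff ℝ (⊤ : ℕ∞) φ) (h2 : HasCompactSupport φ)
    (h3 : tsupport φ ⊆ Ioi 0) :
    (((m:ℝ) + 1)^2 / 4) * (∫ s in Ioi (0:ℝ), (φ s)^2 * (1 + s^2) ^ ((1:ℝ)/2) * s^m) ≤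
    ∫ s in Ioi (0:ℝ), (deriv φ s)^2 * (1 + s^2) ^ ((1:ℝ)/2) * s^(m+2) := by
  set G : ℝ → ℝ := fun s => (φ s)^2 * (1 + s^2) ^ ((1:ℝ)/2) * s^(m+1) with hG
  have hGs : ContDiff ℝ 1 G := by
    have := ((h1.pow 2).mul aux_w_contDiff).mul (contDiff_id.pow (m+1))
    exact this.of_le (by exact_mod_cast le_top)
  have hsq : HasCompactSupport (fun s => (φ s)^2) :=
    h2.comp_left (g := fun y : ℝ => y^2) (by simp)
  have hdsq : HasCompactSupport (fun s => (deriv φ s)^2) :=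
    h2.deriv.comp_left (g := fun y : ℝ => y^2) (by simp)
  have hGc : HasCompactSupport G := hsq.mul_right.mul_right
  have hdc : Continuous (deriv φ) := h1.continuous_deriv (by exact_mod_cast le_top)
  have hint := hGc.integral_Ioi_deriv_eq hGs 0
  have hG0 : G 0 = 0 := by simp [hG]
  rw [hG0, neg_zero] at hint
  have i1 : Integrable (fun s => (φ s)^2 * (1 + s^2) ^ ((1:ℝ)/2) * s^m) := by
    apply Continuous.integrable_of_hasCompactSupport
    · exact ((h1.continuous.pow 2).mul aux_w_contDiff.continuous).mul (continuous_pow m)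
    · exact hsq.mul_right.mul_right
  have i2 : Integrable (fun s => (deriv φ s)^2 * (1 + s^2) ^ ((1:ℝ)/2) * s^(m+2)) := by
    apply Continuous.integrable_of_hasCompactSupport
    · exact ((hdc.pow 2).mul aux_w_contDiff.continuous).mul (continuous_pow _)
    · exact hdsq.mul_right.mul_right
  have i3 : Integrable (deriv G) :=
    (hGs.continuous_deriv le_rfl).integrable_of_hasCompactSupport hGc.deriv
  have key : ∫ s in Ioi (0:ℝ), ((((m:ℝ) + 1)^2 / 4) * ((φ s)^2 * (1 + s^2) ^ ((1:ℝ)/2) * s^m)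
      - ((m:ℝ)+1)/2 * deriv G s) ≤
      ∫ s in Ioi (0:ℝ), (deriv φ s)^2 * (1 + s^2) ^ ((1:ℝ)/2) * s^(m+2) := by
    apply setIntegral_mono_on
    · exact ((i1.const_mul _).sub (i3.const_mul _)).integrableOn
    · exact i2.integrableOn
    · exact measurableSet_Ioi
    · intro s hs
      have hs : 0 < s := hs
      have hφ : HasDerivAt φ (deriv φ s) s :=
        (h1.differentiable (by simp) s).hasDerivAt
      have hd := ((hφ.pow 2).mul (aux_w_deriv s)).mul (hasDerivAt_pow (m+1) s)
      have hd' : deriv G s = _ := hd.deriv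
      rw [hd']
      have hw' : 0 < (1 + s^2) ^ ((1:ℝ)/2 - 1) := by positivity
      have hw : 0 < (1 + s^2) ^ ((1:ℝ)/2) := by positivity
      simp only [Pi.mul_apply, Pi.pow_apply]
      generalize (1 + s^2) ^ ((1:ℝ)/2 - 1) = w' at *
      generalize (1 + s^2) ^ ((1:ℝ)/2) = w at *
      have e1 : 0 ≤ w * s^m * (s * deriv φ s + ((m:ℝ)+1)/2 * φ s)^2 := by positivity
      have e2 : 0 ≤ ((m:ℝ)+1)/2 * ((φ s)^2 * (s * w') * s^(m+1)) := by positivity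
      push_cast
      simp only [Nat.add_sub_cancel, pow_succ] at *
      nlinarith [e1, e2]
  rw [integral_sub (i1.const_mul _).integrableOn (i3.const_mul _).integrableOn,
    integral_const_mul, integral_const_mul, hint] at key
  simpa using key

lemma aux_cov (k : ℝ) (hk : 0 < k) (f : ℝ → ℝ) :
    ∫ s in Ioi (0:ℝ), f s = k * ∫ u, exp (k*u) * f (exp (k*u)) := by
  have h := integral_image_eq_integral_abs_deriv_smul (s := univ) (f := exp) (f' := exp)
    MeasurableSet.univ (fun x _ => (Real.hasDerivAt_exp x).hasDerivWithinAt)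
    (Real.exp_injective.injOn) f
  rw [image_univ, Real.range_exp] at h
  rw [h, Measure.integral_comp_mul_left (fun t => exp t * f (exp t)) k]
  simp only [abs_exp, smul_eq_mul, Measure.restrict_univ, abs_inv, abs_of_pos hk]
  field_simp

noncomputable def auxphi (a k : ℝ) (η : ℝ → ℝ) (s : ℝ) : ℝ :=
  if 0 < s then exp (-a * log s) * η (log s / k) else 0

lemma aux_smooth (a k : ℝ) (hk : 0 < k) (η : ℝ → ℝ) (h1 : ContDiff ℝ (⊤ : ℕ∞) η)
    (hs : ∀ u, u ≤ -3 → η u = 0) : ContDiff ℝ (⊤ : ℕ∞) (auxphi a k η) := by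
  rw [contDiff_iff_contDiffAt]
  intro s
  by_cases hs0 : 0 < s
  · have : ContDiffAt ℝ (⊤ : ℕ∞) (fun s => exp (-a * log s) * η (log s / k)) s := by
      have hl : ContDiffAt ℝ (⊤ : ℕ∞) log s := Real.contDiffAt_log.2 hs0.ne'
      exact ((contDiffAt_const.mul hl).exp).mul
        (h1.contDiffAt.comp s (hl.div_const k))
    refine this.congr_of_eventuallyEq ?_
    filter_upwards [lt_mem_nhds hs0] with x hx
    simp [auxphi, hx]
  · have : ContDiffAt ℝ (⊤ : ℕ∞) (fun _ : ℝ => (0:ℝ)) s := contDiffAt_const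
    refine this.congr_of_eventuallyEq ?_
    have hs' : s < exp (-3 * k) := lt_of_le_of_lt (not_lt.1 hs0) (exp_pos _)
    filter_upwards [gt_mem_nhds hs'] with x hx
    unfold auxphi
    split_ifs with h
    · rw [hs, mul_zero]
      rw [div_le_iff₀ hk]
      exact ((Real.log_lt_iff_lt_exp h).2 hx).le
    · rfl

lemma aux_supp (a k : ℝ) (hk : 0 < k) (η : ℝ → ℝ)
    (hs : ∀ u, u ≤ -3 → η u = 0) (hs2 : ∀ u, -1 ≤ u → η u = 0) :
    tsupport (auxphi a k η) ⊆ Icc (exp (-3*k)) (exp (-1*k)) := by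
  apply closure_minimal _ isClosed_Icc
  intro s h
  by_contra hc
  apply h
  unfold auxphi
  split_ifs with h0
  · rw [mem_Icc, not_and_or, not_le, not_le] at hc
    rcases hc with hc | hc
    · rw [hs, mul_zero]
      rw [div_le_iff₀ hk]
      exact ((Real.log_lt_iff_lt_exp h0).2 hc).le
    · rw [hs2, mul_zero]
      rw [le_div_iff₀ hk]
      exact ((Real.lt_log_iff_exp_lt h0).2 hc).le
  · rfl

lemma aux_val (a k : ℝ) (hk : 0 < k) (η : ℝ → ℝ) (u : ℝ) :
    auxphi a k η (exp (k*u)) = exp (-a * (k*u)) * η u := by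
  simp only [auxphi, exp_pos, if_true, log_exp]
  rw [mul_div_cancel_left₀ _ hk.ne']

lemma aux_dval (a k : ℝ) (hk : 0 < k) (η : ℝ → ℝ) (h1 : ContDiff ℝ (⊤ : ℕ∞) η) (u : ℝ) :
    deriv (auxphi a k η) (exp (k*u)) =
      exp (-a * (k*u)) * (exp (k*u))⁻¹ * (deriv η u / k - a * η u) := by
  have hl : HasDerivAt log (exp (k*u))⁻¹ (exp (k*u)) := Real.hasDerivAt_log (exp_pos _).ne'
  have e : log (exp (k*u)) / k = u := by rw [log_exp, mul_div_cancel_left₀ _ hk.ne']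
  have hη : HasDerivAt η (deriv η u) (log (exp (k*u)) / k) := by
    rw [e]; exact (h1.differentiable (by simp) u).hasDerivAt
  have hd := ((hl.const_mul (-a)).exp).mul (hη.comp (exp (k*u)) (hl.div_const k))
  have : auxphi a k η =ᶠ[nhds (exp (k*u))]
      ((fun x => exp (-a * log x)) * (η ∘ fun x => log x / k)) := by
    filter_upwards [lt_mem_nhds (exp_pos (k*u))] with x hx
    simp [auxphi, hx]
  rw [this.deriv_eq, hd.deriv]
  simp only [Function.comp, e]
  rw [log_exp]
  ring

lemma aux_bump : ∃ η : ℝ → ℝ, ContDiff ℝ (⊤ : ℕ∞) η ∧ HasCompactSupport η ∧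
      (∀ u, u ≤ -3 → η u = 0) ∧ (∀ u, -1 ≤ u → η u = 0) ∧ η (-2) = 1 := by
  let b : ContDiffBump (-2 : ℝ) := ⟨1/2, 1, by norm_num, by norm_num⟩
  refine ⟨b, b.contDiff, b.hasCompactSupport, ?_, ?_, ?_⟩
  · intro u hu
    apply b.zero_of_le_dist
    rw [Real.dist_eq, le_abs]; right
    change (1:ℝ) ≤ _
    linarith
  · intro u hu
    apply b.zero_of_le_dist
    rw [Real.dist_eq, le_abs]; left
    change (1:ℝ) ≤ _
    linarith
  · apply b.one_of_mem_closedBall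
    exact Metric.mem_closedBall_self b.rIn_pos.le

lemma aux_exp (m : ℕ) (a k : ℝ) (ha : a = ((m:ℝ)+1)/2) (u : ℝ) :
    exp (k*u) * exp (-a * (k*u))^2 * exp (k*u)^m = 1 := by
  rw [← Real.exp_nat_mul, ← Real.exp_nat_mul, ← Real.exp_add, ← Real.exp_add, Real.exp_eq_one_iff]
  rw [ha]; push_cast; ring

lemma aux_eN (m : ℕ) (a k : ℝ) (hk : 0 < k) (ha : a = ((m:ℝ)+1)/2) (η : ℝ → ℝ)
    (h1 : ContDiff ℝ (⊤ : ℕ∞) η) (u : ℝ) :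
    exp (k*u) * ((deriv (auxphi a k η) (exp (k*u)))^2 *
      (1 + (exp (k*u))^2) ^ ((1:ℝ)/2) * (exp (k*u))^(m+2)) =
      (deriv η u / k - a * η u)^2 * (1 + (exp (k*u))^2) ^ ((1:ℝ)/2) := by
  rw [aux_dval a k hk η h1]
  have := aux_exp m a k ha u
  have he := (exp_pos (k*u)).ne'
  generalize (1 + (exp (k*u))^2) ^ ((1:ℝ)/2) = w
  generalize exp (k*u) = x at *
  generalize exp (-a * (k*u)) = y at *
  generalize deriv η u / k - a * η u = z at *
  calc _ = (x * y^2 * x^m) * (z^2 * w) := by field_simp; ring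
    _ = _ := by rw [this, one_mul]

lemma aux_eD (m : ℕ) (a k : ℝ) (hk : 0 < k) (ha : a = ((m:ℝ)+1)/2) (η : ℝ → ℝ) (u : ℝ) :
    exp (k*u) * ((auxphi a k η (exp (k*u)))^2 *
      (1 + (exp (k*u))^2) ^ ((1:ℝ)/2) * (exp (k*u))^m) = (η u)^2 * (1 + (exp (k*u))^2) ^ ((1:ℝ)/2) := by
  rw [aux_val a k hk η]
  have := aux_exp m a k ha u
  generalize (1 + (exp (k*u))^2) ^ ((1:ℝ)/2) = w
  calc _ = (exp (k*u) * exp (-a * (k*u))^2 * exp (k*u)^m) * ((η u)^2 * w) := by ring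
    _ = _ := by rw [this, one_mul]

lemma aux_W1 (k u : ℝ) : 1 ≤ (1 + (exp (k*u))^2) ^ ((1:ℝ)/2) := by
  apply Real.one_le_rpow
  · nlinarith [sq_nonneg (exp (k*u))]
  · norm_num

lemma aux_W2 (k : ℝ) (hk : 0 < k) (u : ℝ) (hu : u ≤ -1) : (1 + (exp (k*u))^2) ^ ((1:ℝ)/2) ≤ 2 := by
  have : exp (k*u) ≤ 1 := by
    rw [Real.exp_le_one_iff]; nlinarith
  have h3 : 1 + (exp (k*u))^2 ≤ 2 := by nlinarith [exp_pos (k*u)]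
  calc (1 + (exp (k*u))^2) ^ ((1:ℝ)/2) ≤ (1 + (exp (k*u))^2) ^ (1:ℝ) := by
        apply Real.rpow_le_rpow_of_exponent_le
        · nlinarith [sq_nonneg (exp (k*u))]
        · norm_num
    _ ≤ 2 := by rwa [Real.rpow_one]

lemma aux_hN (a k : ℝ) (ha0 : 0 < a) (hk1 : 1 ≤ k) (η : ℝ → ℝ)
    (h1 : ContDiff ℝ (⊤ : ℕ∞) η) (h2 : HasCompactSupport η) (hs2 : ∀ u, -1 ≤ u → η u = 0)
    (W : ℝ → ℝ) (hWc : Continuous W) (hW1 : ∀ u, 1 ≤ W u) (hW2 : ∀ u, u ≤ -1 → W u ≤ 2)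
    (R : ℝ → ℝ) (hR : R = fun u => 2 * ((deriv η u)^2 + 2 * a * (|η u| * |deriv η u|)))
    (iD : Integrable (fun u => (η u)^2 * W u)) (iR : Integrable R) :
    ∫ u, (deriv η u / k - a * η u)^2 * W u ≤
      ∫ u, (a^2 * ((η u)^2 * W u) + 1/k * R u) := by
  have hdc : Continuous (deriv η) := h1.continuous_deriv (by exact_mod_cast le_top)
  have hk : 0 < k := by linarith
  apply integral_mono
  · apply Continuous.integrable_of_hasCompactSupport
    · exact (((hdc.div_const k).sub (h1.continuous.const_mul a)).pow 2).mul hWc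
    · apply HasCompactSupport.mul_right
      have := (h2.deriv.comp_left (g := fun y : ℝ => y / k) (by simp)).sub
        (h2.comp_left (g := fun y : ℝ => a * y) (by simp))
      exact this.comp_left (g := fun y : ℝ => y^2) (by simp)
  · exact (iD.const_mul _).add (iR.const_mul _)
  · intro u
    simp only
    have hRu : 0 ≤ R u := by simp only [hR]; positivity
    by_cases hu : u ≤ -1
    · have w1 := hW1 u
      have w2 := hW2 u hu
      have hkk : (deriv η u / k)^2 ≤ 1/k * (deriv η u)^2 := by
        rw [div_pow, div_mul_eq_mul_div, one_mul]
        apply div_le_div_of_nonneg_left (sq_nonneg _) hk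
        nlinarith
      have hx : - (2 * a * (deriv η u / k) * η u) ≤ 1/k * (2 * a * (|η u| * |deriv η u|)) := by
        have : -(η u * deriv η u) ≤ |η u| * |deriv η u| := by
          rw [← abs_mul]; exact neg_le_abs _
        calc _ = (1/k * (2*a)) * (-(η u * deriv η u)) := by ring
          _ ≤ (1/k * (2*a)) * (|η u| * |deriv η u|) := by gcongr
          _ = _ := by ring
      have hS : 0 ≤ 1/k * ((deriv η u)^2 + 2 * a * (|η u| * |deriv η u|)) := by positivity
      have hA : (deriv η u / k - a * η u)^2 ≤ a^2 * (η u)^2 +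
          1/k * ((deriv η u)^2 + 2 * a * (|η u| * |deriv η u|)) := by nlinarith
      have hB := mul_le_mul_of_nonneg_right hA (by linarith : 0 ≤ W u)
      have hC := mul_le_mul_of_nonneg_left w2 hS
      simp only [hR]
      linarith
    · have hz : ∀ᶠ x in nhds u, η x = 0 := by
        filter_upwards [lt_mem_nhds (not_le.1 hu)] with x hx
        exact hs2 x hx.le
      have hd : deriv η u = 0 := by
        have : η =ᶠ[nhds u] fun _ => (0:ℝ) := hz
        rw [this.deriv_eq]; simp
      have he : η u = 0 := hz.self_of_nhds
      rw [hd, he]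
      have : 0 ≤ 1/k * R u := by positivity
      simpa using this

lemma aux_upper (m : ℕ) (ε : ℝ) (hε : 0 < ε) : ∃ φ : ℝ → ℝ, ContDiff ℝ (⊤ : ℕ∞) φ ∧
    HasCompactSupport φ ∧ tsupport φ ⊆ Ioi 0 ∧ φ ≠ 0 ∧
    (∫ s in Ioi (0:ℝ), (deriv φ s)^2 * (1 + s^2) ^ ((1:ℝ)/2) * s^(m+2)) /
      (∫ s in Ioi (0:ℝ), (φ s)^2 * (1 + s^2) ^ ((1:ℝ)/2) * s^m) < ((m:ℝ) + 1)^2 / 4 + ε := by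
  obtain ⟨η, h1, h2, hs, hs2, hη0⟩ := aux_bump
  obtain ⟨a, ha⟩ : ∃ a : ℝ, a = ((m:ℝ)+1)/2 := ⟨_, rfl⟩
  have ha0 : 0 < a := by rw [ha]; positivity
  have hdc : Continuous (deriv η) := h1.continuous_deriv (by exact_mod_cast le_top)
  have hsq : HasCompactSupport (fun s => (η s)^2) :=
    h2.comp_left (g := fun y : ℝ => y^2) (by simp)
  have hI : 0 < ∫ u, (η u)^2 := by
    apply Continuous.integral_pos_of_hasCompactSupport_nonneg_nonzero (x := -2)
    · exact h1.continuous.pow 2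
    · exact hsq
    · intro u; exact sq_nonneg _
    · simp [hη0]
  obtain ⟨I, hIdef⟩ : ∃ I, I = ∫ u, (η u)^2 := ⟨_, rfl⟩
  rw [← hIdef] at hI
  have iη : Integrable (fun u => (η u)^2) :=
    (h1.continuous.pow 2).integrable_of_hasCompactSupport hsq
  obtain ⟨R, hR⟩ : ∃ R : ℝ → ℝ, R = fun u => 2 * ((deriv η u)^2 + 2 * a * (|η u| * |deriv η u|)) := ⟨_, rfl⟩
  have hdsq : HasCompactSupport (fun s => (deriv η s)^2) :=
    h2.deriv.comp_left (g := fun y : ℝ => y^2) (by simp)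
  have iR1 : Integrable (fun u => (deriv η u)^2) :=
    (hdc.pow 2).integrable_of_hasCompactSupport hdsq
  have hab : HasCompactSupport (fun u => |η u|) :=
    h2.comp_left (g := fun y : ℝ => |y|) (by simp)
  have iR2 : Integrable (fun u => |η u| * |deriv η u|) :=
    (h1.continuous.abs.mul hdc.abs).integrable_of_hasCompactSupport hab.mul_right
  have iR : Integrable R := hR ▸ (iR1.add (iR2.const_mul (2 * a))).const_mul 2
  have hR0 : 0 ≤ ∫ u, R u := integral_nonneg (fun u => by simp only [hR, Pi.zero_apply]; positivity)
  obtain ⟨C, hCdef⟩ : ∃ C, C = ∫ u, R u := ⟨_, rfl⟩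
  rw [← hCdef] at hR0
  obtain ⟨k, hk1, hkC⟩ : ∃ k : ℝ, 1 ≤ k ∧ C < ε * (k * I) := by
    refine ⟨1 + C / (ε * I), ?_, ?_⟩
    · have : 0 ≤ C / (ε * I) := by positivity
      linarith
    · have : ε * ((1 + C / (ε * I)) * I) = ε * I + C := by field_simp
      rw [this]
      have : 0 < ε * I := by positivity
      linarith
  have hk : 0 < k := by linarith
  have hsm := aux_smooth a k hk η h1 hs
  have hsu := aux_supp a k hk η hs hs2
  have hcs : HasCompactSupport (auxphi a k η) :=
    isCompact_Icc.of_isClosed_subset (isClosed_tsupport _) hsu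
  have hpos : tsupport (auxphi a k η) ⊆ Ioi 0 := fun x hx => lt_of_lt_of_le (exp_pos _) (hsu hx).1
  have hne : auxphi a k η ≠ 0 := by
    intro h
    have := congrFun h (exp (k * (-2)))
    rw [aux_val a k hk, hη0] at this
    simp at this
  refine ⟨auxphi a k η, hsm, hcs, hpos, hne, ?_⟩
  rw [div_lt_iff₀ (aux_den_pos m _ hsm hcs hpos hne)]
  rw [aux_cov k hk, aux_cov k hk]
  obtain ⟨W, hW⟩ : ∃ W : ℝ → ℝ, W = fun u => (1 + (exp (k*u))^2) ^ ((1:ℝ)/2) := ⟨_, rfl⟩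
  have hWc : Continuous W := hW ▸ aux_w_contDiff.continuous.comp (by fun_prop)
  have eN := aux_eN m a k hk ha η h1
  have eD := aux_eD m a k hk ha η
  rw [integral_congr_ae (Filter.Eventually.of_forall eN),
    integral_congr_ae (Filter.Eventually.of_forall eD)]
  have hWe : ∀ u, (1 + (exp (k*u))^2) ^ ((1:ℝ)/2) = W u := fun u => by rw [hW]
  simp only [hWe]
  have hW1 : ∀ u, 1 ≤ W u := fun u => hW ▸ aux_W1 k u
  have hW2 : ∀ u, u ≤ -1 → W u ≤ 2 := fun u hu => hW ▸ aux_W2 k hk u hu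
  have iD : Integrable (fun u => (η u)^2 * W u) :=
    ((h1.continuous.pow 2).mul hWc).integrable_of_hasCompactSupport hsq.mul_right
  have hD : I ≤ ∫ u, (η u)^2 * W u := by
    rw [hIdef]
    exact integral_mono iη iD (fun u => by
      have := hW1 u
      simp only
      nlinarith [sq_nonneg (η u)])
  have hN := aux_hN a k ha0 hk1 η h1 h2 hs2 W hWc hW1 hW2 R hR iD iR
  rw [integral_add (iD.const_mul _) (iR.const_mul _), integral_const_mul, integral_const_mul, ← hCdef] at hN
  rw [show ((m:ℝ)+1)^2/4 = a^2 by rw [ha]; ring]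
  generalize (∫ u, (deriv η u / k - a * η u)^2 * W u) = N at hN ⊢
  generalize (∫ u, (η u)^2 * W u) = D at hN hD ⊢
  clear * - hN hD hkC hk hε
  have hN' := mul_le_mul_of_nonneg_left hN hk.le
  have e1 : k * (1/k * C) = C := by field_simp
  have hD' : ε * (k * I) ≤ ε * (k * D) := by gcongr
  rw [mul_add, e1] at hN'
  linarith

theorem stmt_7 (n : ℕ) (hn : 2 ≤ n) :
    sInf {q : ℝ | ∃ φ : ℝ → ℝ, ContDiff ℝ (⊤ : ℕ∞) φ ∧ HasCompactSupport φ ∧ tsupport φ ⊆ Ioi 0 ∧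
      φ ≠ 0 ∧
      q = (∫ s in Ioi (0:ℝ), (deriv φ s)^2 * (1 + s^2) ^ ((1:ℝ)/2) * s^n) /
          (∫ s in Ioi (0:ℝ), (φ s)^2 * (1 + s^2) ^ ((1:ℝ)/2) * s^(n-2))} =
      ((n : ℝ) - 1)^2 / 4 := by
  obtain ⟨m, rfl⟩ : ∃ m, n = m + 2 := ⟨n - 2, by omega⟩
  have e : (((m + 2 : ℕ) : ℝ) - 1)^2 / 4 = ((m:ℝ) + 1)^2 / 4 := by push_cast; ring
  rw [e]
  simp only [Nat.add_sub_cancel]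
  apply csInf_eq_of_forall_ge_of_forall_gt_exists_lt
  · obtain ⟨φ, a1, a2, a3, a4, -⟩ := aux_upper m 1 one_pos
    exact ⟨_, φ, a1, a2, a3, a4, rfl⟩
  · rintro q ⟨φ, a1, a2, a3, a4, rfl⟩
    rw [le_div_iff₀ (aux_den_pos m φ a1 a2 a3 a4)]
    exact aux_lower m φ a1 a2 a3
  · intro w hw
    obtain ⟨φ, a1, a2, a3, a4, a5⟩ := aux_upper m (w - ((m:ℝ) + 1)^2 / 4) (by linarith)
    exact ⟨_, ⟨φ, a1, a2, a3, a4, rfl⟩, by linarith⟩
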